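/- arXiv:2004.02841 — 2 statements merged into one kernel-verified Lean document; each statement's English description precedes it below -/
import Mathlib

section
/- Fix a type α and a decidable predicate `marked : α → Bool`. Define a one-step deletion relation on lists: `l ⟶ l'` holds iff there exists an index `i < l.length` with `marked (l.get i) = true` and `l' = l.eraseIdx i` (i.e., `l'` is obtained from `l` by removing a single marked element). Then deletion order is irrelevant: for every list `l` and every list `l'` reachable from `l` by the reflexive-transitive closure of `⟶` such that `l'` contains no marked element (i.e., `∀ a ∈ l', marked a = false`), one has `l' = l.filter (fun a => !marked a)`. In particular, any two maximal deletion sequences starting from `l` end in the same list. -/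
/-- One-step deletion: `l'` is obtained from `l` by removing a single marked element. -/
def DelStep {α : Type*} (marked : α → Bool) (l l' : List α) : Prop :=
  ∃ i : Fin l.length, marked (l.get i) = true ∧ l' = l.eraseIdx i

theorem filter_eraseIdx_marked {α : Type*} (marked : α → Bool) (l : List α) :
    ∀ (i : ℕ) (h : i < l.length), marked l[i] = true →
      (l.eraseIdx i).filter (fun a => !marked a) = l.filter (fun a => !marked a) := by
  induction l with
  | nil => intro i h; simp at h
  | cons a t ih =>
    intro i h hm
    cases i with
    | zero =>
      have hm' : marked a = true := hm
      simp [hm']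
    | succ i =>
      have hi : i < t.length := by simpa using h
      have hm' : marked t[i] = true := by simpa using hm
      simp only [List.eraseIdx_cons_succ, List.filter_cons, ih i hi hm']

/-- Deletion order is irrelevant: any list reachable from `l` by repeatedly deleting
marked elements that contains no marked element equals `l` with all marked elements
filtered out. -/
theorem deletion_order_irrelevant {α : Type*} (marked : α → Bool)
    (l l' : List α)
    (hreach : Relation.ReflTransGen (DelStep marked) l l')
    (hnomark : ∀ a ∈ l', marked a = false) :
    l' = l.filter (fun a => !marked a) := by
  have key : l'.filter (fun a => !marked a) = l.filter (fun a => !marked a) := by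
    clear hnomark
    induction hreach with
    | refl => rfl
    | tail _ hstep ih =>
      obtain ⟨i, hm, rfl⟩ := hstep
      rw [← ih]
      exact filter_eraseIdx_marked marked _ i.1 i.2 hm
  rw [← key]
  symm
  rw [List.filter_eq_self]
  intro a ha
  simp [hnomark a ha]
end

section
/- Fix a type α and a decidable predicate `marked : α → Bool`. Define a one-step deletion relation on lists: `l ⟶ l'` holds iff there exists an index `i < l.length` with `marked (l.get i) = true` and `l' = l.eraseIdx i`. Then the relation is confluent from any starting list: if `l₁` and `l₂` are both reachable from `l` by the reflexive-transitive closure of `⟶`, then there exists a list `m` reachable from both `l₁` and `l₂` by the reflexive-transitive closure of `⟶`. -/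
theorem DelStep.cons_aux {α : Type*} {marked : α → Bool} (a : α) {l l' : List α}
    (h : DelStep marked l l') : DelStep marked (a :: l) (a :: l') := by
  obtain ⟨i, hi, rfl⟩ := h
  exact ⟨i.succ, by simpa using hi, by simp⟩

theorem DelStep.filter_aux {α : Type*} {marked : α → Bool} (l : List α) :
    ∀ l' : List α, DelStep marked l l' →
      l'.filter (fun a => !marked a) = l.filter (fun a => !marked a) := by
  induction l with
  | nil => rintro l' ⟨i, _⟩; exact i.elim0
  | cons a l ih =>
    rintro l' ⟨⟨i, hi⟩, hm, rfl⟩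
    cases i with
    | zero =>
      have hm' : marked a = true := by simpa using hm
      simp [hm']
    | succ i =>
      have hi' : i < l.length := by simpa using hi
      have := ih (l.eraseIdx i) ⟨⟨i, hi'⟩, by simpa using hm, rfl⟩
      simp only [List.eraseIdx_cons_succ, List.filter_cons, this]

theorem DelStep.reach_aux {α : Type*} (marked : α → Bool) (l : List α) :
    Relation.ReflTransGen (DelStep marked) l (l.filter (fun a => !marked a)) := by
  induction l with
  | nil => exact .refl
  | cons a l ih =>
    by_cases ha : marked a = true
    · refine .head (b := l) ⟨⟨0, by simp⟩, by simpa using ha, by simp⟩ ?_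
      simpa [ha] using ih
    · have := Relation.ReflTransGen.lift (p := DelStep marked) (List.cons a)
        (fun _ _ h => DelStep.cons_aux a h) _ _ ih
      simpa [ha] using this

theorem DelStep.filter_star_aux {α : Type*} {marked : α → Bool} {l l' : List α}
    (h : Relation.ReflTransGen (DelStep marked) l l') :
    l'.filter (fun a => !marked a) = l.filter (fun a => !marked a) := by
  induction h with
  | refl => rfl
  | tail _ h ih => exact (DelStep.filter_aux _ _ h).trans ih

/-- The one-step deletion relation is confluent from any starting list: any two lists
reachable from `l` can be completed to a common list. -/
theorem deletion_confluent {α : Type*} (marked : α → Bool)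
    (l l₁ l₂ : List α)
    (h₁ : Relation.ReflTransGen (DelStep marked) l l₁)
    (h₂ : Relation.ReflTransGen (DelStep marked) l l₂) :
    ∃ m : List α, Relation.ReflTransGen (DelStep marked) l₁ m ∧
      Relation.ReflTransGen (DelStep marked) l₂ m := by
  refine ⟨l.filter (fun a => !marked a), ?_, ?_⟩
  · rw [← DelStep.filter_star_aux h₁]
    exact DelStep.reach_aux marked l₁
  · rw [← DelStep.filter_star_aux h₂]
    exact DelStep.reach_aux marked l₂
end
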